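/- arXiv:1411.3695 — 3 statements merged into one kernel-verified Lean document; each statement's English description precedes it below -/
import Mathlib

section
/- Let d ≥ 1 and let j be an integer with 1 ≤ j ≤ d/2. Then β_{i,i+j}(K[sd(Δ_{d-1})]) ≠ 0 for every integer i with j ≤ i ≤ 2^{2j-3} + j (the upper bound being read as the rational number 1/2 + 1 when j = 1). -/
open Finset BigOperators

noncomputable section
open scoped Classical

/-- A finite abstract simplicial complex on (a finite subset of) `ℕ`,
given as its finite set of faces. -/
abbrev SC := Finset (Finset ℕ)

/-- `Δ` is a simplicial complex: it is closed under taking subsets of faces. -/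
def IsComplex {α : Type*} [DecidableEq α] (Δ : Finset (Finset α)) : Prop :=
  ∀ s ∈ Δ, ∀ t ⊆ s, t ∈ Δ

/-- The vertex set (ground set) of a complex: the union of all of its faces. -/
def vertexSet {α : Type*} [DecidableEq α] (Δ : Finset (Finset α)) : Finset α :=
  Δ.sup id

/-- The number of vertices of a complex. -/
def nverts {α : Type*} [DecidableEq α] (Δ : Finset (Finset α)) : ℕ :=
  (vertexSet Δ).card

/-- The full `(d-1)`-simplex `Δ_{d-1}`: all subsets of a `d`-element vertex set. -/
def simplexC (d : ℕ) : SC := (Finset.range d).powerset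

/-- The boundary complex of the simplex on `k` vertices (a `(k-2)`-sphere):
all proper subsets of a `k`-element vertex set. -/
def boundaryC (k : ℕ) : SC := ((Finset.range k).powerset).erase (Finset.range k)

/-- Encoding of finite subsets of `ℕ` as natural numbers (injective). -/
def enc : Finset ℕ → ℕ := Encodable.encode

/-- `C` is a chain of sets under inclusion. -/
def IsChainF (C : Finset (Finset ℕ)) : Prop := ∀ s ∈ C, ∀ t ∈ C, s ⊆ t ∨ t ⊆ s

/-- The barycentric subdivision `sd(Δ)`: its vertices are (encodings of) the
nonempty faces of `Δ`, and its faces are the chains of nonempty faces of `Δ`. -/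
def sd (Δ : SC) : SC :=
  ((Δ.erase ∅).powerset.filter IsChainF).image (fun C => C.image enc)

/-- The induced subcomplex `Δ_W` on a vertex subset `W`. -/
def inducedSC {α : Type*} [DecidableEq α] (Δ : Finset (Finset α)) (W : Finset α) :
    Finset (Finset α) := Δ.filter (fun s => s ⊆ W)

/-- `fvec Δ k` is the number of faces of `Δ` of cardinality `k`
(i.e. of dimension `k-1`); so `f_{i}^Δ = fvec Δ (i+1)`. -/
def fvec (Δ : SC) (k : ℕ) : ℕ := (Δ.filter (fun s => s.card = k)).card

/-- A minimal non-face of a complex. -/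
def IsMinNonFace {α : Type*} [DecidableEq α] (Δ : Finset (Finset α)) (N : Finset α) : Prop :=
  N ⊆ vertexSet Δ ∧ N ∉ Δ ∧ ∀ M ⊂ N, M ∈ Δ

/-- `t_1(K[Δ])`: the largest cardinality of a minimal non-face of `Δ`, equivalently the
largest degree of a minimal generator of the Stanley-Reisner ideal `I_Δ`. -/
def t1 {α : Type*} [DecidableEq α] (Δ : Finset (Finset α)) : ℕ :=
  ((vertexSet Δ).powerset.filter (fun N => IsMinNonFace Δ N)).sup Finset.card

/-- A complex is flag if all its minimal non-faces have cardinality `2`. -/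
def IsFlag {α : Type*} [DecidableEq α] (Δ : Finset (Finset α)) : Prop :=
  ∀ N : Finset α, IsMinNonFace Δ N → N.card = 2

/-- A complex is a full simplex if it consists of all subsets of its vertex set. -/
def IsFullSimplex {α : Type*} [DecidableEq α] (Δ : Finset (Finset α)) : Prop :=
  Δ = (vertexSet Δ).powerset

/-- Abstract isomorphism of simplicial complexes (possibly on different ground sets):
there is a map of vertices, injective on the vertex set, carrying the faces of the first
complex exactly onto the faces of the second. -/
def ComplexIso {α β : Type*} [DecidableEq α] [DecidableEq β]
    (Δ : Finset (Finset α)) (Γ : Finset (Finset β)) : Prop :=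
  ∃ φ : α → β, Set.InjOn φ ↑(vertexSet Δ) ∧ Γ = Δ.image (fun s => s.image φ)

variable (K : Type*) [Field K]

/-- The boundary of (the indicator chain of) a single face, with the usual signs coming
from the ordering of the vertices. -/
def bdryFace (s : Finset ℕ) : Finset ℕ →₀ K :=
  ∑ v ∈ s, ((-1 : K) ^ ((s.filter (fun w => w < v)).card)) • Finsupp.single (s.erase v) (1 : K)

/-- The simplicial boundary operator on the (augmented/reduced) chain space. -/
def bdry : (Finset ℕ →₀ K) →ₗ[K] (Finset ℕ →₀ K) :=
  Finsupp.lsum K fun s => LinearMap.toSpanSingleton K (Finset ℕ →₀ K) (bdryFace K s)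

/-- The span of the faces of `Δ` of cardinality `n` (empty for `n < 0`):
the space of `(n-1)`-dimensional reduced chains of `Δ`. -/
def facesSpan (Δ : SC) (n : ℤ) : Submodule K (Finset ℕ →₀ K) :=
  Submodule.span K ((fun s => Finsupp.single s (1 : K)) '' {s | s ∈ Δ ∧ (s.card : ℤ) = n})

/-- Reduced `(n-1)`-cycles of `Δ`. -/
def cyclesOn (Δ : SC) (n : ℤ) : Submodule K (Finset ℕ →₀ K) :=
  facesSpan K Δ n ⊓ LinearMap.ker (bdry K)

/-- Reduced `(n-1)`-boundaries of `Δ`. -/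
def boundariesOn (Δ : SC) (n : ℤ) : Submodule K (Finset ℕ →₀ K) :=
  Submodule.map (bdry K) (facesSpan K Δ (n + 1))

/-- `redHdim K Δ n = dim_K H̃_{n-1}(Δ; K)`, the dimension of reduced simplicial homology
of `Δ` in the degree whose chains are the faces of cardinality `n`. -/
def redHdim (Δ : SC) (n : ℤ) : ℕ :=
  Module.finrank K ↥(cyclesOn K Δ n) -
    Module.finrank K ↥(boundariesOn K Δ n ⊓ cyclesOn K Δ n)

/-- The graded Betti number `β_{i,j}(K[Δ]) = dim_K Tor_i^S(K[Δ], K)_j` of the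
Stanley-Reisner ring of `Δ`, expressed (via Hochster's formula) through reduced homology of
induced subcomplexes: `β_{i,j} = Σ_{W ⊆ Ω, #W = j} dim_K H̃_{j-i-1}(Δ_W; K)`. -/
def bettiSR (Δ : SC) (i j : ℕ) : ℕ :=
  ∑ W ∈ (vertexSet Δ).powerset.filter (fun W => W.card = j),
    redHdim K (inducedSC Δ W) ((j : ℤ) - i)

/-- The projective dimension of `K[Δ]` over the polynomial ring: the largest homological
degree with a nonzero Betti number. -/
def pdimSR (Δ : SC) : ℕ :=
  ((Finset.range (nverts Δ + 1)).filter
    (fun i => ∃ j ∈ Finset.range (2 * nverts Δ + 1), bettiSR K Δ i j ≠ 0)).sup id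

/-- The depth of `K[Δ]` (via the Auslander–Buchsbaum formula). -/
def depthSR (Δ : SC) : ℕ := nverts Δ - pdimSR K Δ

/-- The Castelnuovo–Mumford regularity of `K[Δ]`:
the largest `j - i` with `β_{i,j}(K[Δ]) ≠ 0`. -/
def regSR (Δ : SC) : ℕ :=
  ((Finset.range (nverts Δ + 1) ×ˢ Finset.range (2 * nverts Δ + 1))).sup
    (fun p => if bettiSR K Δ p.1 p.2 ≠ 0 then p.2 - p.1 else 0)

/-- The number of homological degrees `i` with `β_{i,i+j}(K[Δ]) ≠ 0`. -/
def strandCount (Δ : SC) (j : ℕ) : ℕ :=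
  ((Finset.range (nverts Δ + 1)).filter (fun i => bettiSR K Δ i (i + j) ≠ 0)).card

/-- The numbers `m_j(d)`: `m_j(d) = j` if `j ≤ d/2`, and
`m_j(d) = 2^{a+2}(c+d-j) - 2d + j` if `j ≥ d/2`, where `2j-d = a(d-j)+c`, `0 ≤ c < d-j`. -/
def mj (d j : ℕ) : ℕ :=
  if 2 * j ≤ d then j
  else 2 ^ ((2 * j - d) / (d - j) + 2) * ((2 * j - d) % (d - j) + (d - j)) + j - 2 * d

/-- `N(d)`: the number of vertices of `sd^3(Δ_{d-1})` not lying on the boundary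
of `sd^3(Δ_{d-1})`. -/
def Nd (d : ℕ) : ℕ :=
  ((vertexSet (sd^[3] (simplexC d))) \ (vertexSet (sd^[3] (boundaryC d)))).card

/-- The induced subcomplex `σ̃` of `Δ` spanned by the support of a chain `σ`:
all faces of `Δ` contained in some face of the support of `σ`. -/
def cycleCplx (Δ : SC) (σ : Finset ℕ →₀ K) : SC :=
  Δ.filter (fun F => ∃ G ∈ σ.support, F ⊆ G)

/-- `σ` is a minimal homology `(d-1)`-cycle of the `(d-1)`-dimensional complex `Δ`:
a nonzero `(d-1)`-cycle such that no nonzero `(d-1)`-cycle `σ'` satisfies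
`f_i^{σ̃} > f_i^{σ̃'}` and `f_j^{σ̃} = f_j^{σ̃'}` for all `i < j ≤ d-1`, for some `i`. -/
def IsMinimalCycle (Δ : SC) (d : ℕ) (σ : Finset ℕ →₀ K) : Prop :=
  σ ≠ 0 ∧ σ ∈ cyclesOn K Δ (d : ℤ) ∧
    ∀ σ' : Finset ℕ →₀ K, σ' ≠ 0 → σ' ∈ cyclesOn K Δ (d : ℤ) →
      ¬ ∃ i ≤ d - 1, fvec (cycleCplx K Δ σ') (i + 1) < fvec (cycleCplx K Δ σ) (i + 1) ∧
          ∀ j, i < j → j ≤ d - 1 →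
            fvec (cycleCplx K Δ σ) (j + 1) = fvec (cycleCplx K Δ σ') (j + 1)

/-- The support of a lattice point, as a set of natural numbers. -/
def tupSupp {n : ℕ} (a : Fin n → ℕ) : Finset ℕ :=
  (Finset.univ.filter (fun l : Fin n => a l ≠ 0)).image Fin.val

/-- The `k`-th component of `𝔦(a) = Σ_l a_l u_l`, where `u_l = e_l + ⋯ + e_n`;
so `𝔦(a)_k = Σ_{l ≤ k} a_l`. -/
def iComp {n : ℕ} (a : Fin n → ℤ) (k : Fin n) : ℤ :=
  ∑ l ∈ Finset.univ.filter (fun l : Fin n => l ≤ k), a l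

/-- The compatibility condition on pairs of vertices in the edgewise subdivision:
`𝔦(a-b) ∈ {0,1}^n` or `𝔦(b-a) ∈ {0,1}^n`. -/
def edgeOK {n : ℕ} (a b : Fin n → ℕ) : Prop :=
  (∀ k, iComp (fun l => (a l : ℤ) - (b l : ℤ)) k ∈ ({0, 1} : Set ℤ)) ∨
  (∀ k, iComp (fun l => (b l : ℤ) - (a l : ℤ)) k ∈ ({0, 1} : Set ℤ))

/-- The `r`-th edgewise subdivision of a complex `Δ` on vertex set `[n]`, as a complex on
the ground set `Ω_{r,n}` of lattice points (tuples). -/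
def edgewiseT (n r : ℕ) (Δ : SC) : Finset (Finset (Fin n → ℕ)) :=
  (Finset.Nat.antidiagonalTuple n r).powerset.filter
    (fun F => F.sup tupSupp ∈ Δ ∧ ∀ a ∈ F, ∀ b ∈ F, edgeOK a b)

/-- Encoding of lattice points as natural numbers (injective). -/
def encTup {n : ℕ} (a : Fin n → ℕ) : ℕ := Encodable.encode (List.ofFn a)

/-- The `r`-th edgewise subdivision `Δ^{⟨r⟩}`, re-encoded as a complex on `ℕ`. -/
def edgewise (n r : ℕ) (Δ : SC) : SC :=
  (edgewiseT n r Δ).image (fun F => F.image encTup)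

end



section helpers
variable (K : Type*) [Field K]

theorem h_facesSpan (Δ : SC) (n : ℤ) :
    facesSpan K Δ n = Finsupp.supported K K {s | s ∈ Δ ∧ (s.card : ℤ) = n} := by
  rw [Finsupp.supported_eq_span_single]; rfl

theorem h_bdry_single (s : Finset ℕ) (r : K) :
    bdry K (Finsupp.single s r) = r • bdryFace K s := by
  simp [bdry, LinearMap.toSpanSingleton_apply]

noncomputable def sgnI (a : ℕ) (s : Finset ℕ) : K := (-1 : K) ^ ((s.filter (fun w => w < a)).card)

/-- cone operator -/
noncomputable def coneV (a : ℕ) : (Finset ℕ →₀ K) →ₗ[K] (Finset ℕ →₀ K) :=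
  Finsupp.lsum K fun s => LinearMap.toSpanSingleton K (Finset ℕ →₀ K)
    (Finsupp.single (insert a s) (sgnI K a s))

theorem coneV_single (a : ℕ) (s : Finset ℕ) (r : K) :
    coneV K a (Finsupp.single s r) = Finsupp.single (insert a s) (r * sgnI K a s) := by
  simp [coneV, LinearMap.toSpanSingleton_apply]

theorem sgnI_sq (a : ℕ) (s : Finset ℕ) : sgnI K a s * sgnI K a s = 1 := by
  unfold sgnI
  rw [← mul_pow]; simp

theorem sgnI_ne (a : ℕ) (s : Finset ℕ) : sgnI K a s ≠ 0 := by
  intro h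
  have := sgnI_sq K a s
  rw [h] at this; simp at this

theorem sgnI_insert (a v : ℕ) (s : Finset ℕ) (ha : a ∉ s) :
    sgnI K v (insert a s) = (if a < v then -1 else 1) * sgnI K v s := by
  unfold sgnI
  rw [Finset.filter_insert]
  split_ifs with h
  · rw [Finset.card_insert_of_notMem (by simp [ha]), pow_succ]; ring
  · simp

theorem bdryFace_eq (s : Finset ℕ) :
    bdryFace K s = ∑ v ∈ s, Finsupp.single (s.erase v) (sgnI K v s) := by
  unfold bdryFace sgnI
  refine Finset.sum_congr rfl fun v _ => ?_
  simp

theorem bdry_cone_single (a : ℕ) (s : Finset ℕ) (ha : a ∉ s) :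
    bdry K (coneV K a (Finsupp.single s 1)) =
      Finsupp.single s 1 - coneV K a (bdry K (Finsupp.single s 1)) := by
  rw [coneV_single, h_bdry_single, h_bdry_single, bdryFace_eq, bdryFace_eq,
    Finset.sum_insert ha]
  simp only [one_mul, one_smul, map_sum, coneV_single, smul_add]
  rw [Finset.erase_insert ha, sgnI_insert K a a s ha]
  simp only [lt_irrefl, if_false, one_mul, Finsupp.smul_single, smul_eq_mul, sgnI_sq]
  rw [sub_eq_add_neg, ← Finset.sum_neg_distrib, Finset.smul_sum]
  congr 1
  refine Finset.sum_congr rfl fun v hv => ?_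
  have hva : v ≠ a := fun h => ha (h ▸ hv)
  rw [Finset.erase_insert_of_ne hva.symm, Finsupp.smul_single, ← Finsupp.single_neg]
  congr 1
  rw [sgnI_insert K a v s ha, smul_eq_mul]
  have h2 : sgnI K a s = (if v < a then -1 else 1) * sgnI K a (s.erase v) := by
    conv_lhs => rw [← Finset.insert_erase hv]
    exact sgnI_insert K v a _ (by simp)
  rw [h2]
  rcases lt_or_gt_of_ne hva with h | h
  · simp [h, h.not_gt]; ring
  · simp [h, h.not_gt]; ring

theorem bdry_cone (a : ℕ) (z : Finset ℕ →₀ K) (hz : ∀ s ∈ z.support, a ∉ s) :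
    bdry K (coneV K a z) = z - coneV K a (bdry K z) := by
  have hs : z = ∑ s ∈ z.support, z s • Finsupp.single s (1 : K) := by
    conv_lhs => rw [← Finsupp.sum_single z]
    simp [Finsupp.sum]
  have key : ∀ s ∈ z.support, bdry K (coneV K a (z s • Finsupp.single s (1 : K)))
      = z s • Finsupp.single s (1 : K) - coneV K a (bdry K (z s • Finsupp.single s (1 : K))) := by
    intro s h
    simp only [map_smul]
    rw [bdry_cone_single K a s (hz s h), smul_sub]
  conv_lhs => rw [hs]
  conv_rhs => rw [hs]
  simp only [map_sum]
  rw [Finset.sum_congr rfl key, Finset.sum_sub_distrib]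

theorem coneV_apply_insert (a : ℕ) (z : Finset ℕ →₀ K) (hz : ∀ s ∈ z.support, a ∉ s)
    (c : Finset ℕ) (hc : a ∉ c) : coneV K a z (insert a c) = z c * sgnI K a c := by
  have : coneV K a z = z.sum fun s r => Finsupp.single (insert a s) (r * sgnI K a s) := by
    rw [coneV, Finsupp.lsum_apply]
    refine Finset.sum_congr rfl fun s _ => ?_
    simp [LinearMap.toSpanSingleton_apply]
  rw [this, Finsupp.sum_apply, Finsupp.sum]
  rw [Finset.sum_eq_single c]
  · simp
  · intro s hs hne
    apply Finsupp.single_eq_of_ne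
    intro h
    apply hne
    rw [← Finset.erase_insert (hz s hs), ← h, Finset.erase_insert hc]
  · intro h
    simp at h; simp [h]

theorem coneV_supp (a : ℕ) (z : Finset ℕ →₀ K) (t : Finset ℕ) (ht : t ∈ (coneV K a z).support) :
    ∃ s ∈ z.support, t = insert a s := by
  have : coneV K a z = z.sum fun s r => Finsupp.single (insert a s) (r * sgnI K a s) := by
    rw [coneV, Finsupp.lsum_apply]
    refine Finset.sum_congr rfl fun s _ => ?_
    simp [LinearMap.toSpanSingleton_apply]
  rw [Finsupp.mem_support_iff, this, Finsupp.sum_apply, Finsupp.sum] at ht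
  obtain ⟨s, hs, hne⟩ := Finset.exists_ne_zero_of_sum_ne_zero ht
  refine ⟨s, hs, ?_⟩
  by_contra h
  exact hne (Finsupp.single_eq_of_ne h)

theorem bdry_supp (y : Finset ℕ →₀ K) (c : Finset ℕ) (hc : bdry K y c ≠ 0) :
    ∃ s ∈ y.support, c ⊆ s ∧ s.card = c.card + 1 := by
  have : bdry K y = y.sum fun s r => r • bdryFace K s := by
    rw [bdry, Finsupp.lsum_apply]
    refine Finset.sum_congr rfl fun s _ => ?_
    simp [LinearMap.toSpanSingleton_apply]
  rw [this, Finsupp.sum_apply, Finsupp.sum] at hc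
  obtain ⟨s, hs, hne⟩ := Finset.exists_ne_zero_of_sum_ne_zero hc
  refine ⟨s, hs, ?_⟩
  rw [bdryFace_eq, Finsupp.smul_apply, Finsupp.finsetSum_apply] at hne
  have hne' := right_ne_zero_of_smul hne
  obtain ⟨v, hv, hvne⟩ := Finset.exists_ne_zero_of_sum_ne_zero hne'
  have : c = s.erase v := by
    by_contra h
    exact hvne (Finsupp.single_eq_of_ne h)
  subst this
  exact ⟨Finset.erase_subset _ _, (Finset.card_erase_add_one hv).symm⟩

/-- criterion for nonvanishing of the homology -/
theorem redH_ne (Δ : SC) (n : ℤ) (z : Finset ℕ →₀ K) (hz : z ∈ cyclesOn K Δ n)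
    (hnz : z ∉ boundariesOn K Δ n) : redHdim K Δ n ≠ 0 := by
  have hfd : FiniteDimensional K (facesSpan K Δ n) := by
    unfold facesSpan
    apply FiniteDimensional.span_of_finite
    apply Set.Finite.image
    exact (Δ.finite_toSet).subset fun s hs => hs.1
  have hfd2 : FiniteDimensional K (cyclesOn K Δ n) :=
    Submodule.finiteDimensional_of_le (inf_le_left : cyclesOn K Δ n ≤ facesSpan K Δ n)
  have hlt : boundariesOn K Δ n ⊓ cyclesOn K Δ n < cyclesOn K Δ n := by
    refine lt_of_le_of_ne inf_le_right fun h => hnz ?_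
    rw [← h] at hz
    exact hz.1
  have := Submodule.finrank_lt_finrank_of_lt hlt
  unfold redHdim
  omega

def fF (k : ℕ) : Finset ℕ := Finset.range (2 * k + 1)
def fG (k : ℕ) : Finset ℕ := insert (2 * k + 1) (Finset.range (2 * k))
def fCP (k : ℕ) : Finset (Finset ℕ) := (Finset.range k).image fF ∪ (Finset.range k).image fG

theorem mem_fCP (k : ℕ) (S : Finset ℕ) :
    S ∈ fCP k ↔ ∃ l < k, S = fF l ∨ S = fG l := by
  simp only [fCP, Finset.mem_union, Finset.mem_image, Finset.mem_range]
  constructor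
  · rintro (⟨l, h, rfl⟩ | ⟨l, h, rfl⟩)
    · exact ⟨l, h, Or.inl rfl⟩
    · exact ⟨l, h, Or.inr rfl⟩
  · rintro ⟨l, h, rfl | rfl⟩
    · exact Or.inl ⟨l, h, rfl⟩
    · exact Or.inr ⟨l, h, rfl⟩

theorem enc_inj : Function.Injective enc := Encodable.encode_injective

theorem fCP_sub (k : ℕ) (S : Finset ℕ) (h : S ∈ fCP k) : S ⊆ Finset.range (2 * k) := by
  obtain ⟨l, hl, rfl | rfl⟩ := (mem_fCP k S).1 h
  · intro x hx; simp [fF] at hx ⊢; omega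
  · intro x hx; simp [fG] at hx ⊢; omega

theorem range_sub_F (k : ℕ) : Finset.range (2 * k) ⊆ fF k := by
  intro x hx; simp [fF] at hx ⊢; omega
theorem range_sub_G (k : ℕ) : Finset.range (2 * k) ⊆ fG k := by
  intro x hx; simp [fG] at hx ⊢; omega

theorem F_notMem (k : ℕ) : fF k ∉ fCP k := fun h => by
  have := fCP_sub k _ h (show 2 * k ∈ fF k by simp [fF])
  simp at this
theorem G_notMem (k : ℕ) : fG k ∉ fCP k := fun h => by
  have := fCP_sub k _ h (show 2 * k + 1 ∈ fG k by simp [fG])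
  simp at this

theorem FG_incomp (k : ℕ) : ¬ (fF k ⊆ fG k) ∧ ¬ (fG k ⊆ fF k) := by
  constructor
  · intro h
    have := h (show 2 * k ∈ fF k by simp [fF])
    simp [fG] at this
  · intro h
    have := h (show 2 * k + 1 ∈ fG k by simp [fG])
    simp [fF] at this

theorem F_ne_G (k : ℕ) : fF k ≠ fG k := fun h => (FG_incomp k).1 (h ▸ Finset.Subset.refl _)

theorem fCP_succ (k : ℕ) : fCP (k + 1) = insert (fF k) (insert (fG k) (fCP k)) := by
  ext S
  simp only [mem_fCP, Finset.mem_insert, Nat.lt_succ_iff_lt_or_eq]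
  constructor
  · rintro ⟨l, h | rfl, h' | h'⟩
    · exact Or.inr (Or.inr ⟨l, h, Or.inl h'⟩)
    · exact Or.inr (Or.inr ⟨l, h, Or.inr h'⟩)
    · exact Or.inl h'
    · exact Or.inr (Or.inl h')
  · rintro (h | h | ⟨l, h, h'⟩)
    · exact ⟨k, Or.inr rfl, Or.inl h⟩
    · exact ⟨k, Or.inr rfl, Or.inr h⟩
    · exact ⟨l, Or.inl h, h'⟩

theorem card_fCP (k : ℕ) : (fCP k).card = 2 * k := by
  induction k with
  | zero => rfl
  | succ k ih =>
    rw [fCP_succ, Finset.card_insert_of_notMem, Finset.card_insert_of_notMem (G_notMem k), ih]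
    · ring
    · simp [F_ne_G, F_notMem]

def cC (k : ℕ) : Finset ℕ := ((Finset.range k).image fF).image enc

def goodS (k : ℕ) (s : Finset ℕ) : Prop :=
  ∃ C : Finset (Finset ℕ), C ⊆ fCP k ∧ IsChainF C ∧ s = C.image enc ∧ s.card = k

theorem goodS_insert (k : ℕ) (s : Finset ℕ) (h : goodS k s) (A : Finset ℕ)
    (hA : A = fF k ∨ A = fG k) : goodS (k + 1) (insert (enc A) s) := by
  obtain ⟨C, hC, hch, rfl, hcard⟩ := h
  have hsub : Finset.range (2 * k) ⊆ A := by
    rcases hA with rfl | rfl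
    exacts [range_sub_F k, range_sub_G k]
  have hn : A ∉ fCP k := by
    rcases hA with rfl | rfl
    exacts [F_notMem k, G_notMem k]
  refine ⟨insert A C, ?_, ?_, ?_, ?_⟩
  · rw [fCP_succ]
    intro S hS
    rcases Finset.mem_insert.1 hS with rfl | hS
    · rcases hA with h | h <;> simp [h]
    · simp [hC hS]
  · intro S hS T hT
    rcases Finset.mem_insert.1 hS with e | hS' <;> rcases Finset.mem_insert.1 hT with e' | hT'
    · left; rw [e, e']
    · right; rw [e]; exact (fCP_sub k _ (hC hT')).trans hsub
    · left; rw [e']; exact (fCP_sub k _ (hC hS')).trans hsub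
    · exact hch S hS' T hT'
  · rw [Finset.image_insert]
  · rw [Finset.card_insert_of_notMem, hcard]
    rw [enc_inj.mem_finset_image]
    exact fun h => hn (hC h)

theorem exists_cycle (k : ℕ) : ∃ z : Finset ℕ →₀ K,
    (∀ s ∈ z.support, goodS k s) ∧ bdry K z = 0 ∧ z (cC k) ≠ 0 := by
  induction k with
  | zero =>
    refine ⟨Finsupp.single ∅ 1, ?_, ?_, ?_⟩
    · intro s hs
      have : s = ∅ := by
        by_contra h
        rw [Finsupp.mem_support_iff] at hs
        exact hs (Finsupp.single_eq_of_ne h)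
      subst this
      exact ⟨∅, by simp, by simp [IsChainF], by simp, by simp⟩
    · rw [h_bdry_single, bdryFace_eq]; simp
    · simp [cC]
  | succ k ih =>
    obtain ⟨z, hz, hb, hc⟩ := ih
    have hnot : ∀ A, A ∉ fCP k → ∀ s ∈ z.support, enc A ∉ s := by
      intro A hA s hs
      obtain ⟨C, hC, -, rfl, -⟩ := hz s hs
      rw [enc_inj.mem_finset_image]
      exact fun h => hA (hC h)
    have hF := hnot _ (F_notMem k)
    have hG := hnot _ (G_notMem k)
    have hcs : cC k ∈ z.support := by simpa using hc
    have hcC : cC (k + 1) = insert (enc (fF k)) (cC k) := by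
      simp [cC, Finset.range_add_one, Finset.image_insert]
    refine ⟨coneV K (enc (fF k)) z - coneV K (enc (fG k)) z, ?_, ?_, ?_⟩
    · intro s hs
      rcases Finset.mem_union.1 (Finsupp.support_sub hs) with h | h
      · obtain ⟨t, ht, rfl⟩ := coneV_supp K _ _ _ h
        exact goodS_insert k t (hz t ht) _ (Or.inl rfl)
      · obtain ⟨t, ht, rfl⟩ := coneV_supp K _ _ _ h
        exact goodS_insert k t (hz t ht) _ (Or.inr rfl)
    · rw [map_sub, bdry_cone K _ z hF, bdry_cone K _ z hG, hb]; simp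
    · rw [hcC, Finsupp.sub_apply, coneV_apply_insert K _ z hF _ (hF _ hcs)]
      have : coneV K (enc (fG k)) z (insert (enc (fF k)) (cC k)) = 0 := by
        by_contra h
        obtain ⟨t, ht, he⟩ := coneV_supp K _ _ _ (Finsupp.mem_support_iff.2 h)
        have h1 : enc (fG k) ∈ insert (enc (fF k)) (cC k) := he ▸ Finset.mem_insert_self _ _
        rcases Finset.mem_insert.1 h1 with h2 | h2
        · exact F_ne_G k (enc_inj h2).symm
        · exact hG _ hcs h2
      rw [this, sub_zero]
      exact mul_ne_zero hc (sgnI_ne K _ _)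

theorem mem_sd (d : ℕ) (s : Finset ℕ) : s ∈ sd (simplexC d) ↔
    ∃ C : Finset (Finset ℕ), (∀ S ∈ C, S ≠ ∅ ∧ S ⊆ Finset.range d) ∧ IsChainF C ∧
      C.image enc = s := by
  simp only [sd, simplexC, Finset.mem_image, Finset.mem_filter, Finset.mem_powerset]
  constructor
  · rintro ⟨C, ⟨h1, h2⟩, h3⟩
    exact ⟨C, fun S hS => by simpa using h1 hS, h2, h3⟩
  · rintro ⟨C, h1, h2, h3⟩
    exact ⟨C, ⟨fun S hS => by simpa using h1 S hS, h2⟩, h3⟩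

theorem betti_ne (d j i : ℕ) (hj2 : 2 * j ≤ d) (hj1 : 1 ≤ j) (T : Finset (Finset ℕ))
    (hT : ∀ S ∈ T, S ≠ ∅ ∧ S ⊆ Finset.Ico 1 (2 * j) ∧ S ≠ {1})
    (hcard : T.card + j = i) :
    bettiSR K (sd (simplexC d)) i (i + j) ≠ 0 := by
  obtain ⟨z, hz, hb, hc⟩ := exists_cycle K j
  have hT0 : ∀ S ∈ T, 0 ∉ S := fun S hS h => by
    have := (hT S hS).2.1 h
    simp at this
  have hdisj : Disjoint (fCP j) T := by
    rw [Finset.disjoint_left]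
    intro S hS hS'
    obtain ⟨l, hl, rfl | rfl⟩ := (mem_fCP j S).1 hS
    · exact hT0 _ hS' (by simp [fF])
    · rcases Nat.eq_zero_or_pos l with rfl | hl0
      · exact (hT _ hS').2.2 (by simp [fG])
      · exact hT0 _ hS' (by simp [fG]; omega)
  have hprop : ∀ S ∈ fCP j ∪ T, S ≠ ∅ ∧ S ⊆ Finset.range d := by
    intro S hS
    rcases Finset.mem_union.1 hS with h | h
    · refine ⟨?_, (fCP_sub j S h).trans (Finset.range_mono hj2)⟩
      obtain ⟨l, hl, rfl | rfl⟩ := (mem_fCP j S).1 h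
      · simp [fF]
      · simp [fG]
    · refine ⟨(hT S h).1, fun x hx => ?_⟩
      have := (hT S h).2.1 hx
      simp at this ⊢; omega
  have hWcard : ((fCP j ∪ T).image enc).card = i + j := by
    rw [Finset.card_image_of_injective _ enc_inj, Finset.card_union_of_disjoint hdisj, card_fCP]
    omega
  have hWmem : (fCP j ∪ T).image enc ∈
      (vertexSet (sd (simplexC d))).powerset.filter (fun W => W.card = i + j) := by
    rw [Finset.mem_filter, Finset.mem_powerset]
    refine ⟨?_, hWcard⟩
    intro v hv
    obtain ⟨S, hS, rfl⟩ := Finset.mem_image.1 hv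
    unfold vertexSet
    rw [Finset.mem_sup]
    refine ⟨{enc S}, ?_, by simp⟩
    rw [mem_sd]
    refine ⟨{S}, ?_, ?_, by simp⟩
    · intro S' h'
      rw [Finset.mem_singleton.1 h']; exact hprop S hS
    · intro s hs t ht
      rw [Finset.mem_singleton.1 hs, Finset.mem_singleton.1 ht]
      left; exact Finset.Subset.refl _
  unfold bettiSR
  intro h0
  have h1 := (Finset.sum_eq_zero_iff.1 h0) _ hWmem
  have hij : (((i + j : ℕ) : ℤ) - (i : ℤ)) = (j : ℤ) := by push_cast; ring
  rw [hij] at h1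
  refine redH_ne K _ _ z ?_ ?_ h1
  · refine ⟨?_, by simpa using hb⟩
    rw [SetLike.mem_coe, h_facesSpan, Finsupp.mem_supported]
    intro s hs
    obtain ⟨C, hC, hch, rfl, hcd⟩ := hz s hs
    refine ⟨?_, by exact_mod_cast hcd⟩
    unfold inducedSC
    rw [Finset.mem_filter]
    refine ⟨(mem_sd d _).2 ⟨C, fun S hS => hprop S (Finset.mem_union_left _ (hC hS)), hch, rfl⟩, ?_⟩
    exact Finset.image_subset_image (hC.trans Finset.subset_union_left)
  · rintro ⟨y, hy, rfl⟩
    obtain ⟨s, hs, hcs, hcard'⟩ := bdry_supp K y _ hc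
    rw [SetLike.mem_coe, h_facesSpan, Finsupp.mem_supported] at hy
    obtain ⟨hsΔ, -⟩ := hy hs
    unfold inducedSC at hsΔ
    rw [Finset.mem_filter] at hsΔ
    obtain ⟨hsd, hsW⟩ := hsΔ
    obtain ⟨C, hC, hch, rfl⟩ := (mem_sd d s).1 hsd
    have hex : ∃ v ∈ C.image enc, v ∉ cC j := by
      by_contra hcon
      push Not at hcon
      have := Finset.card_le_card (show C.image enc ⊆ cC j from hcon)
      omega
    obtain ⟨v, hv, hvn⟩ := hex
    obtain ⟨S, hS, rfl⟩ := Finset.mem_image.1 hv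
    have hSW : S ∈ fCP j ∪ T := (enc_inj.mem_finset_image).1 (hsW hv)
    have hFC : ∀ l < j, fF l ∈ C := fun l hl =>
      (enc_inj.mem_finset_image).1 (hcs (Finset.mem_image_of_mem _
        (Finset.mem_image_of_mem _ (Finset.mem_range.2 hl))))
    have hSnF : ∀ l < j, S ≠ fF l := fun l hl h => hvn (by
      rw [h]
      exact Finset.mem_image_of_mem _ (Finset.mem_image_of_mem _ (Finset.mem_range.2 hl)))
    rcases Finset.mem_union.1 hSW with h | h
    · obtain ⟨l, hl, h' | h'⟩ := (mem_fCP j S).1 h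
      · exact hSnF l hl h'
      · subst h'
        rcases hch _ hS _ (hFC l hl) with h | h
        · exact (FG_incomp l).2 h
        · exact (FG_incomp l).1 h
    · have hF0 : fF 0 = {0} := by simp [fF]
      have h0S := hT0 S h
      rcases hch _ hS _ (hFC 0 hj1) with h' | h'
      · rw [hF0, Finset.subset_singleton_iff] at h'
        rcases h' with h' | h'
        · exact (hT S h).1 h'
        · exact h0S (by simp [h'])
      · exact h0S (h' (by simp [hF0]))

end helpers

/-- For `1 ≤ j ≤ d/2` one has `β_{i,i+j}(K[sd(Δ_{d-1})]) ≠ 0` for all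
`j ≤ i ≤ 2^{2j-3} + j` (the upper bound read as the rational number `1/2 + 1` for
`j = 1`). -/
theorem statement_8 (K : Type*) [Field K] (d j : ℕ) (hd : 1 ≤ d) (hj1 : 1 ≤ j)
    (hj2 : 2 * j ≤ d) (i : ℕ) (h1 : j ≤ i)
    (h2 : (i : ℚ) ≤ (2 : ℚ) ^ (2 * (j : ℤ) - 3) + (j : ℚ)) :
    bettiSR K (sd (simplexC d)) i (i + j) ≠ 0 := by
  have hbound : i - j + 2 ≤ 2 ^ (2 * j - 1) := by
    obtain ⟨m, rfl⟩ : ∃ m, j = m + 1 := ⟨j - 1, by omega⟩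
    rcases m with _ | m
    · norm_num at h2
      have : (i : ℚ) < 2 := by linarith
      have : i < 2 := by exact_mod_cast this
      have : i = 1 := by omega
      subst this; norm_num
    · have he : (2 * ((m + 1 + 1 : ℕ) : ℤ) - 3) = ((2 * m + 1 : ℕ) : ℤ) := by push_cast; ring
      rw [he, zpow_natCast] at h2
      have h3 : i ≤ 2 ^ (2 * m + 1) + (m + 1 + 1) := by exact_mod_cast h2
      have h4 : 2 * (m + 1 + 1) - 1 = (2 * m + 1) + 2 := by omega
      rw [h4, pow_add]
      have h5 : 1 ≤ 2 ^ (2 * m + 1) := Nat.one_le_two_pow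
      omega
  have hc : i - j ≤ (((Finset.Ico 1 (2 * j)).powerset.erase ∅).erase {1}).card := by
    have a1 := Finset.pred_card_le_card_erase (s := (Finset.Ico 1 (2 * j)).powerset) (a := ∅)
    have a2 := Finset.pred_card_le_card_erase
      (s := (Finset.Ico 1 (2 * j)).powerset.erase ∅) (a := {1})
    have a3 : (Finset.Ico 1 (2 * j)).powerset.card = 2 ^ (2 * j - 1) := by simp
    omega
  obtain ⟨T, hT, hTc⟩ := Finset.exists_subset_card_eq hc
  refine betti_ne K d j i hj2 hj1 T ?_ (by omega)
  intro S hS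
  have := hT hS
  simp only [Finset.mem_erase, Finset.mem_powerset] at this
  exact ⟨this.2.1, this.2.2, this.1⟩
end

section
/- Let d ≥ 1 and let j be an integer with d/2 < j ≤ d-2. Then β_{i,i+j}(K[sd(Δ_{d-1})]) ≠ 0 for every integer i with m_j(d) ≤ i ≤ 2^{j+1} - 2 - j. -/
open Finset BigOperators

namespace Pf
open scoped Classical

noncomputable section
variable (K : Type*) [Field K]

def eps (s : Finset ℕ) (v : ℕ) : K := (-1 : K) ^ ((s.filter (fun w => w < v)).card)

lemma eps_sq (s : Finset ℕ) (v : ℕ) : eps K s v * eps K s v = 1 := by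
  unfold eps
  rw [← mul_pow]; simp

lemma eps_ne (s : Finset ℕ) (v : ℕ) : eps K s v ≠ 0 := by
  intro h
  have := eps_sq K s v
  simp [h] at this

lemma eps_erase_self (s : Finset ℕ) (v : ℕ) : eps K (s.erase v) v = eps K s v := by
  unfold eps
  congr 2
  ext w; simp; intro h _; omega

lemma eps_insert_self (s : Finset ℕ) (v : ℕ) : eps K (insert v s) v = eps K s v := by
  unfold eps
  congr 2
  ext w; simp; intro h _; omega

lemma eps_insert_gt (s : Finset ℕ) (u v : ℕ) (h : u < v) :
    eps K (insert v s) u = eps K s u := by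
  unfold eps
  congr 2
  ext w; simp; intro h _; omega

lemma eps_insert_lt (s : Finset ℕ) (u v : ℕ) (h : v < u) (hv : v ∉ s) :
    eps K (insert v s) u = - eps K s u := by
  unfold eps
  rw [Finset.filter_insert, if_pos h, Finset.card_insert_of_notMem (by simp [hv]), pow_succ]
  ring

lemma eps_swap (s : Finset ℕ) (u v : ℕ) (hu : u ∈ s) (hv : v ∉ s) :
    eps K s v * eps K (insert v s) u = - (eps K s u * eps K (s.erase u) v) := by
  have hne : u ≠ v := fun h => hv (h ▸ hu)
  have e : insert u (s.erase u) = s := Finset.insert_erase hu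
  rcases lt_or_gt_of_ne hne with h | h
  · rw [eps_insert_gt K s u v h]
    have := eps_insert_lt K (s.erase u) v u h (by simp)
    rw [e] at this
    rw [this]; ring
  · rw [eps_insert_lt K s u v h hv]
    have := eps_insert_gt K (s.erase u) v u h
    rw [e] at this
    rw [this]; ring

/-- wedge -/
def wd (v : ℕ) : (Finset ℕ →₀ K) →ₗ[K] (Finset ℕ →₀ K) :=
  Finsupp.lsum K fun s => LinearMap.toSpanSingleton K (Finset ℕ →₀ K)
    (if v ∈ s then 0 else eps K s v • Finsupp.single (insert v s) (1 : K))

/-- contraction -/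
def ct (v : ℕ) : (Finset ℕ →₀ K) →ₗ[K] (Finset ℕ →₀ K) :=
  Finsupp.lsum K fun s => LinearMap.toSpanSingleton K (Finset ℕ →₀ K)
    (if v ∈ s then eps K s v • Finsupp.single (s.erase v) (1 : K) else 0)

lemma wd_single (v : ℕ) (s : Finset ℕ) : wd K v (Finsupp.single s 1) =
    if v ∈ s then 0 else eps K s v • Finsupp.single (insert v s) (1 : K) := by
  rw [wd, Finsupp.lsum_single, LinearMap.toSpanSingleton_apply, one_smul]

lemma ct_single (v : ℕ) (s : Finset ℕ) : ct K v (Finsupp.single s 1) =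
    if v ∈ s then eps K s v • Finsupp.single (s.erase v) (1 : K) else 0 := by
  rw [ct, Finsupp.lsum_single, LinearMap.toSpanSingleton_apply, one_smul]

lemma bdry_single (s : Finset ℕ) : bdry K (Finsupp.single s 1) =
    ∑ v ∈ s, eps K s v • Finsupp.single (s.erase v) (1 : K) := by
  rw [bdry, Finsupp.lsum_single, LinearMap.toSpanSingleton_apply, one_smul]
  rfl

lemma ext_single {f g : (Finset ℕ →₀ K) →ₗ[K] (Finset ℕ →₀ K)}
    (h : ∀ s, f (Finsupp.single s 1) = g (Finsupp.single s 1)) : f = g := by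
  apply Finsupp.lhom_ext'
  intro s
  apply LinearMap.ext_ring
  exact h s

lemma ct_wd (v : ℕ) (c : Finset ℕ →₀ K) : ct K v (wd K v c) + wd K v (ct K v c) = c := by
  have : (ct K v ∘ₗ wd K v + wd K v ∘ₗ ct K v) = LinearMap.id := by
    apply ext_single
    intro s
    simp only [LinearMap.add_apply, LinearMap.comp_apply, LinearMap.id_apply, wd_single, ct_single]
    by_cases h : v ∈ s
    · rw [if_pos h, if_pos h, map_zero, zero_add, map_smul, wd_single, if_neg (by simp),
        eps_erase_self, smul_smul, eps_sq, one_smul, Finset.insert_erase h]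
    · rw [if_neg h, if_neg h, map_zero, add_zero, map_smul, ct_single, if_pos (by simp),
        eps_insert_self, smul_smul, eps_sq, one_smul, Finset.erase_insert h]
  exact LinearMap.congr_fun this c

lemma bdry_wd (v : ℕ) (c : Finset ℕ →₀ K) :
    bdry K (wd K v c) = c - wd K v (bdry K c) := by
  have : (bdry K ∘ₗ wd K v + wd K v ∘ₗ bdry K) = LinearMap.id := by
    apply ext_single
    intro s
    simp only [LinearMap.add_apply, LinearMap.comp_apply, LinearMap.id_apply, wd_single,
      bdry_single, map_sum, map_smul]
    by_cases h : v ∈ s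
    · rw [Finset.sum_eq_single v]
      · simp [h, eps_erase_self, smul_smul, eps_sq]
      · intro b _ hb
        simp [h, Ne.symm hb]
      · intro h'; exact absurd h h'
    · simp only [h, if_false, map_smul, bdry_single, Finset.sum_insert h, smul_add, smul_smul,
        eps_insert_self, eps_sq, Finset.erase_insert h, one_smul, Finset.smul_sum, add_assoc]
      rw [← Finset.sum_add_distrib, Finset.sum_eq_zero, add_zero]
      intro u hu
      have hne : u ≠ v := fun e => h (e ▸ hu)
      rw [eps_swap K s u v hu h, Finset.erase_insert_of_ne hne.symm]
      simp [h, smul_smul]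
  have := LinearMap.congr_fun this c
  simp only [LinearMap.add_apply, LinearMap.comp_apply, LinearMap.id_apply] at this
  rw [eq_sub_iff_add_eq]; exact this

lemma bdry_bdry (c : Finset ℕ →₀ K) : bdry K (bdry K c) = 0 := by
  have : bdry K ∘ₗ bdry K = 0 := by
    apply ext_single
    intro s
    simp only [LinearMap.comp_apply, LinearMap.zero_apply]
    induction s using Finset.induction_on with
    | empty => simp [bdry_single]
    | insert v s hv ih =>
      have e : Finsupp.single (insert v s) (1 : K) = eps K s v • wd K v (Finsupp.single s 1) := by
        rw [wd_single, if_neg hv, smul_smul, eps_sq, one_smul]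
      rw [e, map_smul, map_smul, bdry_wd, map_sub, bdry_wd, ih]
      simp
  exact LinearMap.congr_fun this c

/-- subdivision map with base cycle `z` and base set `B` -/
def S (z : Finset ℕ →₀ K) (B : Finset ℕ) (A : Finset ℕ) : Finset ℕ →₀ K :=
  if A = ∅ then z else
    wd K (enc (B ∪ A)) (∑ v ∈ A.attach, eps K A v • S z B (A.erase v))
termination_by A.card
decreasing_by exact Finset.card_erase_lt_of_mem v.2

/-- value of `S` on the boundary of `A` -/
def S' (z : Finset ℕ →₀ K) (B : Finset ℕ) (A : Finset ℕ) : Finset ℕ →₀ K :=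
  ∑ v ∈ A, eps K A v • S K z B (A.erase v)

lemma S_empty (z : Finset ℕ →₀ K) (B : Finset ℕ) : S K z B ∅ = z := by
  rw [S]; simp

lemma S_ne (z : Finset ℕ →₀ K) (B A : Finset ℕ) (h : A ≠ ∅) :
    S K z B A = wd K (enc (B ∪ A)) (S' K z B A) := by
  rw [S, if_neg h, S', ← Finset.sum_attach A]

def SL (z : Finset ℕ →₀ K) (B : Finset ℕ) : (Finset ℕ →₀ K) →ₗ[K] (Finset ℕ →₀ K) :=
  Finsupp.lsum K fun s => LinearMap.toSpanSingleton K (Finset ℕ →₀ K) (S K z B s)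

lemma SL_single (z : Finset ℕ →₀ K) (B s : Finset ℕ) :
    SL K z B (Finsupp.single s 1) = S K z B s := by
  rw [SL, Finsupp.lsum_single, LinearMap.toSpanSingleton_apply, one_smul]

lemma SL_bdry (z : Finset ℕ →₀ K) (B s : Finset ℕ) :
    SL K z B (bdry K (Finsupp.single s 1)) = S' K z B s := by
  simp only [bdry_single, map_sum, map_smul, SL_single, S']

lemma bdry_S (z : Finset ℕ →₀ K) (hz : bdry K z = 0) (B : Finset ℕ) (n : ℕ) :
    ∀ A : Finset ℕ, A.card = n → bdry K (S K z B A) = S' K z B A ∧ bdry K (S' K z B A) = 0 := by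
  induction n with
  | zero =>
    intro A hA
    rw [Finset.card_eq_zero] at hA
    subst hA
    simp [S_empty, hz, S']
  | succ n ih =>
    intro A hA
    have h2 : bdry K (S' K z B A) = 0 := by
      have : bdry K (S' K z B A) = SL K z B (bdry K (bdry K (Finsupp.single A 1))) := by
        rw [bdry_single, map_sum, map_sum, S', map_sum]
        refine Finset.sum_congr rfl fun v hv => ?_
        rw [map_smul, map_smul, map_smul, SL_bdry,
          (ih (A.erase v) (by rw [Finset.card_erase_of_mem hv, hA]; rfl)).1]
      rw [this, bdry_bdry, map_zero]
    refine ⟨?_, h2⟩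
    rw [S_ne, bdry_wd, h2, map_zero, sub_zero]
    rintro rfl
    simp at hA

/-- encoded chains in `U` with `n` elements -/
def Fam (U : Finset (Finset ℕ)) (n : ℕ) : Submodule K (Finset ℕ →₀ K) :=
  Submodule.span K ((fun C : Finset (Finset ℕ) => Finsupp.single (C.image enc) (1 : K)) ''
    {C | C ⊆ U ∧ IsChainF C ∧ C.card = n})

lemma enc_inj : Function.Injective enc := Encodable.encode_injective

lemma Fam_mono {U V : Finset (Finset ℕ)} (h : U ⊆ V) (n : ℕ) : Fam K U n ≤ Fam K V n := by
  apply Submodule.span_mono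
  apply Set.image_mono
  rintro C ⟨a, b⟩
  exact ⟨a.trans h, b⟩

lemma ct_Fam {U : Finset (Finset ℕ)} {n : ℕ} {c : Finset ℕ →₀ K} (hc : c ∈ Fam K U n)
    {F : Finset ℕ} (hF : F ∉ U) : ct K (enc F) c = 0 := by
  have : Fam K U n ≤ LinearMap.ker (ct K (enc F)) := by
    apply Submodule.span_le.2
    rintro _ ⟨C, ⟨h1, _⟩, rfl⟩
    simp only [SetLike.mem_coe, LinearMap.mem_ker, ct_single]
    rw [if_neg]
    rw [Finset.mem_image]
    rintro ⟨G, hG, e⟩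
    exact hF (enc_inj e ▸ h1 hG)
  exact this hc

lemma wd_Fam {U : Finset (Finset ℕ)} {n : ℕ} {c : Finset ℕ →₀ K} (hc : c ∈ Fam K U n)
    {F : Finset ℕ} (hF : F ∉ U) (hU : ∀ G ∈ U, G ⊆ F) :
    wd K (enc F) c ∈ Fam K (insert F U) (n + 1) := by
  have : Fam K U n ≤ (Fam K (insert F U) (n + 1)).comap (wd K (enc F)) := by
    apply Submodule.span_le.2
    rintro _ ⟨C, ⟨h1, h2, h3⟩, rfl⟩
    simp only [SetLike.mem_coe, Submodule.mem_comap, wd_single]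
    split_ifs
    · exact Submodule.zero_mem _
    · apply Submodule.smul_mem
      apply Submodule.subset_span
      refine ⟨insert F C, ⟨Finset.insert_subset_insert _ h1, ?_, ?_⟩, ?_⟩
      · intro s hs t ht
        rw [Finset.mem_insert] at hs ht
        rcases hs with rfl | hs <;> rcases ht with rfl | ht
        · left; rfl
        · right; exact hU _ (h1 ht)
        · left; exact hU _ (h1 hs)
        · exact h2 s hs t ht
      · rw [Finset.card_insert_of_notMem (fun h => hF (h1 h)), h3]
      · simp only [Finset.image_insert]
  exact this hc

/-- all `B ∪ C`, `C ⊆ A` nonempty, together with `V` -/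
def UU (V : Finset (Finset ℕ)) (B A : Finset ℕ) : Finset (Finset ℕ) :=
  V ∪ (A.powerset.erase ∅).image (fun C => B ∪ C)

/-- same with `C` proper -/
def UP (V : Finset (Finset ℕ)) (B A : Finset ℕ) : Finset (Finset ℕ) :=
  V ∪ ((A.powerset.erase ∅).erase A).image (fun C => B ∪ C)

lemma union_inj {B C D : Finset ℕ} (h1 : Disjoint B C) (h2 : Disjoint B D)
    (h : B ∪ C = B ∪ D) : C = D := by
  have := congrArg (fun X => X \ B) h
  simpa [Finset.union_sdiff_cancel_left h1, Finset.union_sdiff_cancel_left h2] using this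

lemma top_notMem {V : Finset (Finset ℕ)} {B A : Finset ℕ} (hV : ∀ F ∈ V, F ⊆ B)
    (hBA : Disjoint B A) (hA : A ≠ ∅) : B ∪ A ∉ UP V B A := by
  intro h
  rw [UP, Finset.mem_union] at h
  rcases h with h | h
  · have h1 := hV _ h
    obtain ⟨a, ha⟩ := Finset.nonempty_iff_ne_empty.2 hA
    exact Finset.disjoint_left.1 hBA (h1 (Finset.mem_union_right _ ha)) ha
  · simp only [Finset.mem_image, Finset.mem_erase, Finset.mem_powerset] at h
    obtain ⟨C, ⟨h1, h2, h3⟩, h4⟩ := h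
    exact h1 (union_inj (hBA.mono_right h3) hBA h4)

lemma UU_erase_subset_UP {V : Finset (Finset ℕ)} {B A : Finset ℕ} {v : ℕ} (hv : v ∈ A) :
    UU V B (A.erase v) ⊆ UP V B A := by
  unfold UU UP
  apply Finset.union_subset_union_right
  apply Finset.image_subset_image
  intro C hC
  simp only [Finset.mem_erase, Finset.mem_powerset] at hC ⊢
  refine ⟨?_, hC.1, hC.2.trans (Finset.erase_subset _ _)⟩
  rintro rfl
  have := hC.2 hv
  simp at this

lemma S_Fam {V : Finset (Finset ℕ)} {z : Finset ℕ →₀ K} {B : Finset ℕ} {k : ℕ}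
    (hz : z ∈ Fam K V k) (hV : ∀ F ∈ V, F ⊆ B) (n : ℕ) :
    ∀ A : Finset ℕ, Disjoint B A → A.card = n →
      S K z B A ∈ Fam K (UU V B A) (k + n) ∧
      (∀ m, n = m + 1 → S' K z B A ∈ Fam K (UP V B A) (k + m)) := by
  induction n with
  | zero =>
    intro A hBA hA
    rw [Finset.card_eq_zero] at hA
    subst hA
    refine ⟨?_, by simp⟩
    rw [S_empty]
    exact Fam_mono K Finset.subset_union_left _ hz
  | succ n ih =>
    intro A hBA hA
    have hne : A ≠ ∅ := by rintro rfl; simp at hA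
    have h2 : S' K z B A ∈ Fam K (UP V B A) (k + n) := by
      apply Submodule.sum_mem
      intro v hv
      apply Submodule.smul_mem
      apply Fam_mono K (UU_erase_subset_UP hv)
      exact (ih _ (hBA.mono_right (Finset.erase_subset _ _))
        (by rw [Finset.card_erase_of_mem hv, hA]; rfl)).1
    refine ⟨?_, fun m hm => by obtain rfl : n = m := by omega
                               exact h2⟩
    rw [S_ne K z B A hne]
    have := wd_Fam K h2 (top_notMem hV hBA hne) (by
      intro G hG
      rw [UP, Finset.mem_union] at hG
      rcases hG with h | h
      · exact (hV _ h).trans Finset.subset_union_left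
      · simp only [Finset.mem_image, Finset.mem_erase, Finset.mem_powerset] at h
        obtain ⟨C, ⟨h1, h2, h3⟩, rfl⟩ := h
        exact Finset.union_subset_union_right h3)
    refine Fam_mono K ?_ _ this
    apply Finset.insert_subset
    · apply Finset.mem_union_right
      apply Finset.mem_image_of_mem
      simp [hne]
    · unfold UU UP
      apply Finset.union_subset_union_right
      apply Finset.image_subset_image
      exact Finset.erase_subset _ _

lemma S'_ne_zero {V : Finset (Finset ℕ)} {z : Finset ℕ →₀ K} {B : Finset ℕ} {k : ℕ}
    (hz : z ∈ Fam K V k) (hz0 : z ≠ 0) (hV : ∀ F ∈ V, F ⊆ B) (n : ℕ) :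
    ∀ A : Finset ℕ, Disjoint B A → A.card = n + 1 → S' K z B A ≠ 0 := by
  induction n with
  | zero =>
    intro A _ hA
    obtain ⟨a, rfl⟩ := Finset.card_eq_one.1 hA
    simp only [S', Finset.sum_singleton]
    rw [Finset.erase_singleton, S_empty]
    exact smul_ne_zero (eps_ne K _ _) hz0
  | succ n ih =>
    intro A hBA hA h0
    obtain ⟨a, ha⟩ : A.Nonempty := Finset.card_pos.1 (by omega)
    have hc : ∀ v ∈ A, (A.erase v).card = n + 1 := by
      intro v hv; rw [Finset.card_erase_of_mem hv, hA]; rfl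
    have hne : ∀ v ∈ A, A.erase v ≠ ∅ := by
      intro v hv h
      have := hc v hv
      rw [h] at this; simp at this
    have hd : ∀ v, Disjoint B (A.erase v) := fun v => hBA.mono_right (Finset.erase_subset _ _)
    have h1 := congrArg (ct K (enc (B ∪ A.erase a))) h0
    rw [map_zero, S', map_sum, Finset.sum_eq_single a] at h1
    · rw [map_smul, S_ne K z B _ (hne a ha)] at h1
      have h2 := ct_wd K (enc (B ∪ A.erase a)) (S' K z B (A.erase a))
      rw [ct_Fam K ((S_Fam K hz hV (n + 1) _ (hd a) (hc a ha)).2 n rfl)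
        (top_notMem hV (hd a) (hne a ha)), map_zero, add_zero] at h2
      rw [h2] at h1
      exact smul_ne_zero (eps_ne K _ _) (ih _ (hd a) (hc a ha)) h1
    · intro b hb hba
      rw [map_smul, ct_Fam K (S_Fam K hz hV (n + 1) _ (hd b) (hc b hb)).1, smul_zero]
      intro h
      rw [UU, Finset.mem_union] at h
      rcases h with h | h
      · obtain ⟨x, hx⟩ := Finset.nonempty_iff_ne_empty.2 (hne a ha)
        exact Finset.disjoint_left.1 (hd a) (hV _ h (Finset.mem_union_right _ hx)) hx
      · simp only [Finset.mem_image, Finset.mem_erase, Finset.mem_powerset] at h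
        obtain ⟨C, ⟨h1, h2⟩, h3⟩ := h
        have := union_inj ((hd b).mono_right h2) (hd a) h3
        subst this
        have h4 : b ∈ A.erase a := Finset.mem_erase.2 ⟨hba, hb⟩
        have := h2 h4
        simp at this
    · intro h; exact absurd ha h

lemma exists_cycle (L : List ℕ) (hL : ∀ n ∈ L, 1 ≤ n) :
    ∃ (V : Finset (Finset ℕ)) (T : Finset ℕ) (z : Finset ℕ →₀ K),
      (∀ F ∈ V, F ⊆ Finset.range L.sum ∧ F.card ∈ T) ∧ T ⊆ Finset.Ico 1 L.sum ∧
      T.card + L.length = L.sum ∧ V.card ≤ (L.map (fun n => 2 ^ n - 2)).sum ∧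
      z ∈ Fam K V T.card ∧ bdry K z = 0 ∧ z ≠ 0 := by
  induction L with
  | nil =>
    refine ⟨∅, ∅, Finsupp.single ∅ 1, by simp, by simp, by simp, by simp, ?_, ?_, by simp⟩
    · apply Submodule.subset_span
      refine ⟨∅, ⟨by simp, by intro s hs; simp at hs, by simp⟩, by simp⟩
    · simp [bdry_single]
  | cons n L ih =>
    obtain ⟨V, T, z, hV, hT, hc, hVc, hz, hzb, hz0⟩ := ih (fun n hn => hL n (by simp [hn]))
    have hn : 1 ≤ n := hL n (by simp)
    obtain ⟨p, rfl⟩ : ∃ p, n = p + 1 := ⟨n - 1, by omega⟩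
    set m := L.sum with hm
    have hs : (List.sum ((p + 1) :: L)) = m + (p + 1) := by simp [hm]; ring
    have hAc : (Finset.Ico m (m + (p + 1))).card = p + 1 := by simp
    set A := Finset.Ico m (m + (p + 1)) with hA
    have hBA : Disjoint (Finset.range m) A := by
      rw [Finset.disjoint_left]; intro x hx hx'
      simp [hA] at hx hx'; omega
    have hV' : ∀ F ∈ V, F ⊆ Finset.range m := fun F hF => (hV F hF).1
    have hTd : Disjoint T (Finset.Ioo m (m + (p + 1))) := by
      rw [Finset.disjoint_left]; intro x hx hx'
      have := hT hx
      simp at this hx'; omega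
    have hTc : (T ∪ Finset.Ioo m (m + (p + 1))).card = T.card + p := by
      rw [Finset.card_union_of_disjoint hTd]; simp
    refine ⟨UP V (Finset.range m) A, T ∪ Finset.Ioo m (m + (p + 1)), S' K z (Finset.range m) A,
      ?_, ?_, ?_, ?_, ?_, ?_, ?_⟩
    · intro F hF
      rw [hs]
      rw [UP, Finset.mem_union] at hF
      rcases hF with h | h
      · refine ⟨(hV' F h).trans (by simp), Finset.mem_union_left _ (hV F h).2⟩
      · simp only [Finset.mem_image, Finset.mem_erase, Finset.mem_powerset] at h
        obtain ⟨C, ⟨h1, h2, h3⟩, rfl⟩ := h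
        constructor
        · apply Finset.union_subset (by simp)
          refine h3.trans ?_
          intro x hx; simp [hA] at hx ⊢; omega
        · apply Finset.mem_union_right
          rw [Finset.card_union_of_disjoint (hBA.mono_right h3), Finset.card_range, Finset.mem_Ioo]
          have h4 := Finset.card_pos.2 (Finset.nonempty_iff_ne_empty.2 h2)
          have h5 := Finset.card_lt_card (Finset.ssubset_iff_subset_ne.2 ⟨h3, h1⟩)
          omega
    · rw [hs]
      apply Finset.union_subset
      · refine hT.trans ?_
        intro x hx; simp at hx ⊢; omega
      · intro x hx; simp at hx ⊢; omega
    · rw [hs, hTc, List.length_cons]; omega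
    · rw [List.map_cons, List.sum_cons]
      refine (Finset.card_union_le _ _).trans ?_
      have : (((A.powerset.erase ∅).erase A).image (fun C => Finset.range m ∪ C)).card
          ≤ 2 ^ (p + 1) - 2 := by
        refine Finset.card_image_le.trans ?_
        rw [Finset.card_erase_of_mem, Finset.card_erase_of_mem, Finset.card_powerset, hAc]
        · omega
        · simp
        · simp only [Finset.mem_erase, Finset.mem_powerset]
          refine ⟨?_, subset_rfl⟩
          intro h; rw [h] at hAc; simp at hAc
      omega
    · rw [hTc]
      exact (S_Fam K hz hV' (p + 1) A hBA hAc).2 p rfl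
    · exact (bdry_S K z hzb _ _ A rfl).2
    · exact S'_ne_zero K hz hz0 hV' p A hBA hAc

lemma exists_fun (d : ℕ) : ∀ T : Finset ℕ, T ⊆ Finset.Ico 1 d →
    ∃ f : ℕ → ℕ, ∀ s, 1 ≤ s → s ≤ T.card → f s ∈ T ∧ s ≤ f s ∧ f s + (T.card + 1) ≤ d + s := by
  induction d with
  | zero =>
    intro T hT
    have : T = ∅ := by simpa using hT
    subst this
    exact ⟨id, fun s h1 h2 => by simp at h2; omega⟩
  | succ d ih =>
    intro T hT
    by_cases hd : d ∈ T
    · obtain ⟨f, hf⟩ := ih (T.erase d) (by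
        intro x hx
        rw [Finset.mem_erase] at hx
        have := hT hx.2
        simp at this ⊢; omega)
      have hc : (T.erase d).card + 1 = T.card := Finset.card_erase_add_one hd
      have hle := Finset.card_le_card hT
      simp at hle
      refine ⟨fun s => if s = T.card then d else f s, fun s h1 h2 => ?_⟩
      by_cases h : s = T.card
      · simp only [h, if_true]
        exact ⟨hd, hle, by omega⟩
      · simp only [h, if_false]
        obtain ⟨a, b, c⟩ := hf s h1 (by omega)
        exact ⟨Finset.mem_of_mem_erase a, b, by omega⟩
    · obtain ⟨f, hf⟩ := ih T (by
        intro x hx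
        have := hT hx
        have : x ≠ d := fun e => hd (e ▸ hx)
        simp at *; omega)
      refine ⟨f, fun s h1 h2 => ?_⟩
      obtain ⟨a, b, c⟩ := hf s h1 h2
      exact ⟨a, b, by omega⟩

lemma card_BT (d : ℕ) (T : Finset ℕ) (hT : T ⊆ Finset.Ico 1 d) :
    2 ^ (T.card + 1) - 2 ≤ ((Finset.range d).powerset.filter (fun F => F.card ∈ T)).card := by
  obtain ⟨f, hf⟩ := exists_fun d T hT
  set j := T.card with hj
  by_cases hj0 : j = 0
  · rw [hj0]; simp
  have hjd : j + 1 ≤ d := by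
    have := Finset.card_le_card hT
    simp at this; omega
  have hc : (((Finset.range (j + 1)).powerset.erase ∅).erase (Finset.range (j + 1))).card
      = 2 ^ (j + 1) - 2 := by
    rw [Finset.card_erase_of_mem, Finset.card_erase_of_mem, Finset.card_powerset,
      Finset.card_range]
    · omega
    · simp
    · simp
  rw [← hc]
  apply Finset.card_le_card_of_injOn
    (fun A => A ∪ Finset.Ico (j + 1) (j + 1 + (f A.card - A.card)))
  · intro A hA
    simp only [Finset.coe_erase, Set.mem_sdiff, Finset.mem_coe, Finset.mem_powerset,
      Set.mem_singleton_iff, Finset.mem_erase] at hA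
    obtain ⟨⟨h3, h2⟩, h1⟩ := hA
    have h4 := Finset.card_pos.2 (Finset.nonempty_iff_ne_empty.2 h2)
    have h5 := Finset.card_lt_card (Finset.ssubset_iff_subset_ne.2 ⟨h3, h1⟩)
    rw [Finset.card_range] at h5
    obtain ⟨a, b, c⟩ := hf A.card h4 (by omega)
    simp only [Finset.coe_filter, Set.mem_ofPred_eq, Finset.mem_powerset]
    constructor
    · apply Finset.union_subset
      · exact h3.trans (by simpa using hjd)
      · intro x hx; simp at hx ⊢; omega
    · rw [Finset.card_union_of_disjoint]
      · simp only [Nat.card_Ico, Nat.add_sub_cancel_left]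
        rw [show A.card + (f A.card - A.card) = f A.card by omega]
        exact a
      · rw [Finset.disjoint_left]; intro x hx hx'
        have := h3 hx
        simp at this hx'; omega
  · intro A hA C hC h
    simp only [Finset.coe_erase, Set.mem_sdiff, Finset.mem_coe, Finset.mem_powerset,
      Set.mem_singleton_iff, Finset.mem_erase] at hA hC
    have hA1 := hA.1.1
    have hC1 := hC.1.1
    ext x
    have hx := Finset.ext_iff.1 h x
    simp only [Finset.mem_union, Finset.mem_Ico] at hx
    constructor
    · intro h'
      have := hA1 h'
      simp at this
      rcases hx.1 (Or.inl h') with h | h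
      · exact h
      · omega
    · intro h'
      have := hC1 h'
      simp at this
      rcases hx.2 (Or.inl h') with h | h
      · exact h
      · omega

lemma mem_sd (d : ℕ) (s : Finset ℕ) : s ∈ sd (simplexC d) ↔
    ∃ C : Finset (Finset ℕ), C ⊆ (Finset.range d).powerset.erase ∅ ∧ IsChainF C ∧
      C.image enc = s := by
  simp only [sd, simplexC, Finset.mem_image, Finset.mem_filter, Finset.mem_powerset, and_assoc]

lemma main (d j N : ℕ) (V : Finset (Finset ℕ)) (T : Finset ℕ) (z : Finset ℕ →₀ K)
    (hV : ∀ F ∈ V, F ⊆ Finset.range d ∧ F.card ∈ T) (hT : T ⊆ Finset.Ico 1 d)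
    (hTc : T.card = j) (hz : z ∈ Fam K V j) (hzb : bdry K z = 0) (hz0 : z ≠ 0)
    (h1 : V.card ≤ N) (h2 : N ≤ 2 ^ (j + 1) - 2) :
    ∃ W ∈ (vertexSet (sd (simplexC d))).powerset.filter (fun W => W.card = N),
      redHdim K (inducedSC (sd (simplexC d)) W) (j : ℤ) ≠ 0 := by
  obtain ⟨W', hVW, hW, hWc⟩ := Finset.exists_subsuperset_card_eq
    (s := V) (t := (Finset.range d).powerset.filter (fun F => F.card ∈ T)) (n := N)
    (by intro F hF; simpa using hV F hF) h1 (h2.trans (hTc ▸ card_BT d T hT))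
  have hW' : ∀ F ∈ W', F ⊆ Finset.range d ∧ F.card ∈ T := by
    intro F hF; simpa using hW hF
  have hWne : W' ⊆ (Finset.range d).powerset.erase ∅ := by
    intro F hF
    obtain ⟨a, b⟩ := hW' F hF
    simp only [Finset.mem_erase, Finset.mem_powerset]
    refine ⟨?_, a⟩
    rintro rfl
    have := hT b
    simp at this
  have hmem : ∀ C ⊆ W', IsChainF C → C.image enc ∈ inducedSC (sd (simplexC d)) (W'.image enc) := by
    intro C hC hch
    simp only [inducedSC, Finset.mem_filter]
    exact ⟨(mem_sd d _).2 ⟨C, hC.trans hWne, hch, rfl⟩, Finset.image_subset_image hC⟩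
  refine ⟨W'.image enc, ?_, ?_⟩
  · simp only [Finset.mem_filter, Finset.mem_powerset]
    refine ⟨?_, by rw [Finset.card_image_of_injective _ enc_inj, hWc]⟩
    intro x hx
    obtain ⟨F, hF, rfl⟩ := Finset.mem_image.1 hx
    simp only [vertexSet, Finset.mem_sup, id]
    refine ⟨{enc F}, (mem_sd d _).2 ⟨{F}, ?_, ?_, by simp⟩, by simp⟩
    · simpa using hWne hF
    · intro s hs t ht
      simp at hs ht; subst hs ht; left; rfl
  · set Γ := inducedSC (sd (simplexC d)) (W'.image enc) with hΓ
    have hb : facesSpan K Γ ((j : ℤ) + 1) = ⊥ := by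
      rw [facesSpan, Submodule.span_eq_bot]
      rintro _ ⟨s, ⟨hs, hc⟩, rfl⟩
      exfalso
      simp only [hΓ, inducedSC, Finset.mem_filter] at hs
      obtain ⟨hs1, hs2⟩ := hs
      obtain ⟨C, hC1, hC2, rfl⟩ := (mem_sd d s).1 hs1
      rw [Finset.card_image_of_injective _ enc_inj] at hc
      have hCW : C ⊆ W' := (Finset.image_subset_image_iff enc_inj).1 hs2
      have : C.card ≤ T.card := by
        apply Finset.card_le_card_of_injOn Finset.card
        · intro F hF
          exact (hW' F (hCW hF)).2
        · intro F hF G hG h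
          rcases hC2 F hF G hG with h' | h'
          · exact Finset.eq_of_subset_of_card_le h' h.ge
          · exact (Finset.eq_of_subset_of_card_le h' h.le).symm
      omega
    have hb' : boundariesOn K Γ (j : ℤ) = ⊥ := by
      rw [boundariesOn, hb, Submodule.map_bot]
    have hzc : z ∈ cyclesOn K Γ (j : ℤ) := by
      refine ⟨?_, hzb⟩
      refine (Submodule.span_le.2 ?_ : Fam K V j ≤ facesSpan K Γ (j : ℤ)) hz
      rintro _ ⟨C, ⟨hC1, hC2, hC3⟩, rfl⟩
      apply Submodule.subset_span
      refine ⟨C.image enc, ⟨hmem C (hC1.trans hVW) hC2, ?_⟩, rfl⟩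
      rw [Finset.card_image_of_injective _ enc_inj, hC3]
    have hfd : FiniteDimensional K (facesSpan K Γ (j : ℤ)) := by
      apply FiniteDimensional.span_of_finite
      apply Set.Finite.image
      exact (Γ.finite_toSet).subset (fun s hs => hs.1)
    have hfd' : FiniteDimensional K (cyclesOn K Γ (j : ℤ)) :=
      Submodule.finiteDimensional_of_le (inf_le_left)
    rw [redHdim, hb', bot_inf_eq, finrank_bot, Nat.sub_zero]
    intro h
    rw [Submodule.finrank_eq_zero] at h
    rw [h] at hzc
    exact hz0 (by simpa using hzc)

end
end Pf

/-- For `d/2 < j ≤ d-2` one has `β_{i,i+j}(K[sd(Δ_{d-1})]) ≠ 0` for all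
`m_j(d) ≤ i ≤ 2^{j+1} - 2 - j`. -/
theorem statement_9 (K : Type*) [Field K] (d j : ℕ) (hd : 1 ≤ d) (hj1 : d < 2 * j)
    (hj2 : j ≤ d - 2) (i : ℕ) (h1 : mj d j ≤ i) (h2 : i ≤ 2 ^ (j + 1) - 2 - j) :
    bettiSR K (sd (simplexC d)) i (i + j) ≠ 0 := by
  obtain ⟨k, rfl⟩ : ∃ k, d = j + k := ⟨d - j, by omega⟩
  have hk : 2 ≤ k := by omega
  rw [mj, if_neg (by omega), show j + k - j = k by omega] at h1
  have hdiv : k * ((2 * j - (j + k)) / k) + (2 * j - (j + k)) % k = 2 * j - (j + k) :=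
    Nat.div_add_mod _ _
  have hck : (2 * j - (j + k)) % k < k := Nat.mod_lt _ (by omega)
  generalize (2 * j - (j + k)) / k = a at *
  generalize (2 * j - (j + k)) % k = c at *
  obtain ⟨e, he⟩ : ∃ e, k = c + e := ⟨k - c, by omega⟩
  obtain ⟨L, hL⟩ : ∃ L, L = List.replicate c (a + 3) ++ List.replicate e (a + 2) := ⟨_, rfl⟩
  have hsum : L.sum = j + k := by
    simp only [hL, List.sum_append, List.sum_replicate, smul_eq_mul]
    have h3 : c * (a + 3) + e * (a + 2) = (c + e) * a + c + 2 * (c + e) := by ring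
    rw [h3, ← he]; omega
  have hlen : L.length = k := by simp [hL, he]
  obtain ⟨V, T, z, hV, hT, hTc, hVc, hz, hzb, hz0⟩ := Pf.exists_cycle K L (by
    intro n hn
    simp only [hL, List.mem_append, List.mem_replicate] at hn
    rcases hn with ⟨_, rfl⟩ | ⟨_, rfl⟩ <;> omega)
  rw [hsum] at hV hT hTc
  rw [hlen] at hTc
  have hTj : T.card = j := by omega
  rw [hTj] at hz
  have hcard : V.card ≤ i + j := by
    refine hVc.trans ?_
    simp only [hL, List.map_append, List.map_replicate, List.sum_append, List.sum_replicate,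
      smul_eq_mul]
    obtain ⟨q, hq⟩ : ∃ q, 2 ^ (a + 2) = q + 2 :=
      ⟨2 ^ (a + 2) - 2, by have : 2 ^ 1 ≤ 2 ^ (a + 2) := Nat.pow_le_pow_right (by omega) (by omega)
                           omega⟩
    have hq3 : 2 ^ (a + 3) - 2 = 2 * q + 2 := by
      rw [show a + 3 = (a + 2) + 1 by ring, pow_succ, hq]; omega
    rw [hq3, hq, Nat.add_sub_cancel]
    rw [hq] at h1
    have h4 : (q + 2) * (c + k) = c * (2 * q + 2) + e * q + 2 * k := by rw [he]; ring
    omega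
  have htop : i + j ≤ 2 ^ (j + 1) - 2 := by
    have h5 : j + 1 ≤ 2 ^ j := Nat.lt_two_pow_self
    rw [pow_succ] at h2 ⊢
    omega
  obtain ⟨W, hW, hne⟩ := Pf.main K (j + k) j (i + j) V T z hV hT hTj hz hzb hz0 hcard htop
  intro h0
  rw [bettiSR, Finset.sum_eq_zero_iff] at h0
  apply hne
  have := h0 W (by convert hW)
  rwa [show ((i + j : ℕ) : ℤ) - i = j by push_cast; ring] at this
end

section
/- Let d ≥ 3 and d/2 < j ≤ d-1 be integers, let r ≥ 2, and let 0 = i_1 ≤ i_2 ≤ ⋯ ≤ i_r be integers such that i_1+⋯+i_r+(r-1) = j-1 and i_1+⋯+i_r+2r ≤ d. Then (2^{i_r+2} - 2)·2^{i_2+⋯+i_{r-1}+2r-4} + Σ_{ℓ=1}^r (2^{i_ℓ+2} - 2) ≥ 2^{j+1} - 2. -/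
open Finset BigOperators

/-- The numerical inequality of the paper's Lemma for tuples with
`i_1 = 0`. -/
theorem statement_10 (d j r : ℕ) (hd : 3 ≤ d) (hj1 : d < 2 * j) (hj2 : j ≤ d - 1)
    (hr : 2 ≤ r) (iv : ℕ → ℕ) (h0 : iv 1 = 0)
    (hmono : ∀ k, 1 ≤ k → k < r → iv k ≤ iv (k + 1))
    (h1 : (∑ l ∈ Finset.Icc 1 r, iv l) + (r - 1) = j - 1)
    (h2 : (∑ l ∈ Finset.Icc 1 r, iv l) + 2 * r ≤ d) :
    2 ^ (j + 1) - 2 ≤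
      (2 ^ (iv r + 2) - 2) * 2 ^ ((∑ l ∈ Finset.Icc 2 (r - 1), iv l) + 2 * r - 4) +
        ∑ l ∈ Finset.Icc 1 r, (2 ^ (iv l + 2) - 2) := by
  have hj : j = (∑ l ∈ Finset.Icc 1 r, iv l) + r := by omega
  obtain ⟨q, rfl⟩ : ∃ q, r = q + 2 := ⟨r - 2, by omega⟩
  have key : ∀ f : ℕ → ℕ, ∑ l ∈ Finset.Icc 1 (q + 2), f l
      = f 1 + ∑ l ∈ Finset.Icc 2 (q + 1), f l + f (q + 2) := by
    intro f
    rw [Finset.sum_Icc_succ_top (by omega)]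
    congr 1
  rw [key, h0] at hj
  rw [key]
  have hq : q + 2 - 1 = q + 1 := rfl
  rw [hq, h0]
  have he : (∑ l ∈ Finset.Icc 2 (q + 1), iv l) + 2 * (q + 2) - 4
      = (∑ l ∈ Finset.Icc 2 (q + 1), iv l) + 2 * q := by omega
  rw [he]
  match q, hj, hmono with
  | 0, hj, _ =>
    simp at hj ⊢
    subst hj
    have := Nat.pow_le_pow_right (n := 2) (by norm_num) (show 2 ≤ iv 2 + 2 by omega)
    have e : 2 ^ (iv 2 + 2 + 1) = 2 * 2 ^ (iv 2 + 2) := by ring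
    omega
  | 1, hj, hmono =>
    have hm := hmono 2 (by norm_num) (by norm_num)
    simp at hj hm ⊢
    subst hj
    have e1 : 2 ^ (iv 2 + iv 3 + 3 + 1) = 2 ^ (iv 3 + 2) * 2 ^ (iv 2 + 2) := by ring
    have e2 : 2 * 2 ^ (iv 2 + 2) = 2 * 2 ^ (iv 2 + 2) := by ring
    have l1 := Nat.pow_le_pow_right (n := 2) (by norm_num) (show 2 ≤ iv 2 + 2 by omega)
    have l2 := Nat.pow_le_pow_right (n := 2) (by norm_num)
      (show iv 2 + 2 ≤ iv 3 + 2 by omega)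
    rw [e1, Nat.sub_mul]
    have l3 : 2 * 2 ^ (iv 2 + 2) ≤ 2 ^ (iv 3 + 2) * 2 ^ (iv 2 + 2) :=
      Nat.mul_le_mul_right _ (by omega)
    omega
  | p + 2, hj, _ =>
    generalize (∑ l ∈ Finset.Icc 2 (p + 2 + 1), iv l) = M at *
    generalize iv (p + 2 + 2) = a at *
    have l1 : 2 ^ (a + 1) ≤ 2 ^ (a + 2) - 2 := by
      have : 2 ^ (a + 2) = 2 * 2 ^ (a + 1) := by ring
      have := Nat.pow_le_pow_right (n := 2) (by norm_num) (show 1 ≤ a + 1 by omega)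
      omega
    have l2 := Nat.mul_le_mul_right (2 ^ (M + 2 * (p + 2))) l1
    rw [← pow_add] at l2
    have l3 := Nat.pow_le_pow_right (n := 2) (by norm_num)
      (show j + 1 ≤ a + 1 + (M + 2 * (p + 2)) by omega)
    omega
end
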